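/- Let n ≥ 4 be an integer and a, b real numbers with 1 + a² < b², let U = {x ∈ ℝⁿ : a sinh x_{n−2} + b cosh x_{n−2} > 0}, and let L : ℝⁿ → ℝ^{n+2} be immersion (C) (with S = sinh x_{n−2}, C = cosh x_{n−2}, P = ∏_{j=1}^{n−3} cosh x_j: (u₁,u₂,u₃) = (aS+bC)P·(cosh x_{n−1} cosh x_n, cosh x_{n−1} sinh x_n, sinh x_{n−1}); u_{k+3} = sinh(x_k)∏_{j=1}^{k−1} cosh x_j for 1 ≤ k ≤ n−3; u_{n+1} = (√(b²−a²−1)/√(1+a²))CP; u_{n+2} = (abC+(1+a²)S)P/√(1+a²)). Then there exists a smooth map ξ : U → ℝ^{n+2} such that for every x ∈ U: η(ξ(x), ξ(x)) = 1; η(ξ(x), L(x)) = 0; η(ξ(x), ∂L/∂x_i(x)) = 0 for all 1 ≤ i ≤ n; η(∂²L/∂x_i∂x_j(x), ξ(x)) = 0 for every pair (i,j) other than (n−1,n−1) and (n,n); η(∂²L/∂x_{n−1}²(x), ξ(x)) = √(b²−a²−1)(aS+bC)P; and η(∂²L/∂x_n²(x), ξ(x)) = √(b²−a²−1)(aS+bC)P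 cosh²x_{n−1}. In particular the second fundamental form in direction ξ equals λ times the induced metric on the last two coordinate directions and vanishes otherwise, where λ = √(b²−a²−1)/((aS+bC)P) is nowhere zero, so the hypersurface has no minimal points in hyperbolic space. -/

import Mathlib

open Real

/-- The Minkowski (Lorentzian) bilinear form `η(u,v) = -u₁v₁ + Σ_{j≥2} uⱼvⱼ` on `ℝ^{N+1}`. -/
noncomputable def eta {N : ℕ} (u v : EuclideanSpace ℝ (Fin (N + 1))) : ℝ :=
  -(u 0 * v 0) + ∑ j : Fin N, u j.succ * v j.succ

/-- Partial derivative of `L` at `x` in the direction of the `i`-th standard basis vector,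
in the sense of the Fréchet derivative. -/
noncomputable def pd {n : ℕ} {F : Type*} [NormedAddCommGroup F] [NormedSpace ℝ F]
    (L : EuclideanSpace ℝ (Fin n) → F) (x : EuclideanSpace ℝ (Fin n)) (i : Fin n) : F :=
  fderiv ℝ L x (EuclideanSpace.single i 1)

/-- Second partial derivative of `L` at `x` in the directions of the `i`-th and `j`-th
standard basis vectors. -/
noncomputable def pd2 {n : ℕ} {F : Type*} [NormedAddCommGroup F] [NormedSpace ℝ F]
    (L : EuclideanSpace ℝ (Fin n) → F) (x : EuclideanSpace ℝ (Fin n)) (i j : Fin n) : F :=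
  pd (fun y => pd L y i) x j

lemma eta_comm {N : ℕ} (u v : EuclideanSpace ℝ (Fin (N + 1))) : eta u v = eta v u := by
  simp [eta, mul_comm]

/-- The Minkowski form with its first argument fixed, as a continuous linear functional. -/
noncomputable def etaCLM {N : ℕ} (v : EuclideanSpace ℝ (Fin (N + 1))) :
    EuclideanSpace ℝ (Fin (N + 1)) →L[ℝ] ℝ :=
  -(v 0 • EuclideanSpace.proj 0) + ∑ j : Fin N, v j.succ • EuclideanSpace.proj j.succ

lemma etaCLM_apply {N : ℕ} (v w : EuclideanSpace ℝ (Fin (N + 1))) :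
    etaCLM v w = eta v w := by
  simp [etaCLM, eta]

lemma pd_eta {n N : ℕ} {L : EuclideanSpace ℝ (Fin n) → EuclideanSpace ℝ (Fin (N + 1))}
    (v : EuclideanSpace ℝ (Fin (N + 1))) {x : EuclideanSpace ℝ (Fin n)}
    (hL : DifferentiableAt ℝ L x) (i : Fin n) :
    pd (fun y => eta v (L y)) x i = eta v (pd L x i) := by
  have h := (etaCLM v).hasFDerivAt.comp x hL.hasFDerivAt
  have h2 : (fun y => eta v (L y)) = etaCLM v ∘ L := by
    ext y; simp [etaCLM_apply]
  simp [pd, h2, h.fderiv, etaCLM_apply]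

lemma ContDiff.differentiable_pd {n : ℕ} {F : Type*} [NormedAddCommGroup F] [NormedSpace ℝ F]
    {L : EuclideanSpace ℝ (Fin n) → F} (hL : ContDiff ℝ 2 L) (i : Fin n) :
    Differentiable ℝ (fun y => pd L y i) :=
  ((hL.fderiv_right (m := 1) (by norm_num)).differentiable (by norm_num)).clm_apply
    (differentiable_const _)

lemma pd2_eta {n N : ℕ} {L : EuclideanSpace ℝ (Fin n) → EuclideanSpace ℝ (Fin (N + 1))}
    (v : EuclideanSpace ℝ (Fin (N + 1))) (x : EuclideanSpace ℝ (Fin n))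
    (hL : ContDiff ℝ 2 L) (i j : Fin n) :
    pd2 (fun y => eta v (L y)) x i j = eta v (pd2 L x i j) := by
  have h : (fun y => pd (fun y => eta v (L y)) y i) = fun y => eta v (pd L y i) :=
    funext fun y => pd_eta v (hL.differentiable (by norm_num) y) i
  rw [pd2, h, pd_eta v (hL.differentiable_pd i x), pd2]

lemma pd_mul {n : ℕ} {F g : EuclideanSpace ℝ (Fin n) → ℝ} {x : EuclideanSpace ℝ (Fin n)}
    (hF : DifferentiableAt ℝ F x) (hg : DifferentiableAt ℝ g x) (i : Fin n) :
    pd (fun y => F y * g y) x i = F x * pd g x i + g x * pd F x i := by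
  simp [pd, fderiv_fun_mul hF hg]

lemma pd2_mul_of_critical_zero {n : ℕ} {F g : EuclideanSpace ℝ (Fin n) → ℝ}
    {x : EuclideanSpace ℝ (Fin n)} (hF : ContDiff ℝ 2 F) (hg : ContDiff ℝ 2 g)
    (hx : g x = 0) (hdx : ∀ i, pd g x i = 0) (i j : Fin n) :
    pd2 (fun y => F y * g y) x i j = F x * pd2 g x i j := by
  have hF' := hF.differentiable (by norm_num)
  have hg' := hg.differentiable (by norm_num)
  have h : (fun y => pd (fun y => F y * g y) y i) =
      fun y => F y * pd g y i + g y * pd F y i := funext fun y => pd_mul (hF' y) (hg' y) i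
  have hadd : pd (fun y => F y * pd g y i + g y * pd F y i) x j =
      pd (fun y => F y * pd g y i) x j + pd (fun y => g y * pd F y i) x j := by
    rw [pd, fderiv_fun_add ((hF' x).fun_mul (hg.differentiable_pd i x))
      ((hg' x).fun_mul (hF.differentiable_pd i x))]
    rfl
  rw [pd2, h, hadd, pd_mul (hF' x) (hg.differentiable_pd i x),
    pd_mul (hg' x) (hF.differentiable_pd i x), hx, hdx i, hdx j, pd2]
  ring

lemma pd_eq_of_hasFDerivAt {n : ℕ} {g : EuclideanSpace ℝ (Fin n) → ℝ}
    {g' : EuclideanSpace ℝ (Fin n) →L[ℝ] ℝ} {x : EuclideanSpace ℝ (Fin n)}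
    (h : HasFDerivAt g g' x) (i : Fin n) :
    pd g x i = g' (EuclideanSpace.single i 1) := by
  rw [pd, h.fderiv]

lemma hasFDerivAt_coord {n : ℕ} (p : Fin n) (y : EuclideanSpace ℝ (Fin n)) :
    HasFDerivAt (fun y : EuclideanSpace ℝ (Fin n) => y p)
      (EuclideanSpace.proj p : EuclideanSpace ℝ (Fin n) →L[ℝ] ℝ) y :=
  (EuclideanSpace.proj p : EuclideanSpace ℝ (Fin n) →L[ℝ] ℝ).hasFDerivAt

/-- The Minkowski product of the points of the hyperbolic plane with coordinates `(u₀, v₀)` and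
`(y p, y q)`, shifted to vanish at the common point and scaled by `-r`. -/
noncomputable def planeGap {n : ℕ} (r u₀ v₀ : ℝ) (p q : Fin n) (y : EuclideanSpace ℝ (Fin n)) : ℝ :=
  r * (cosh u₀ * (cosh (y p) * cosh (y q - v₀)) - sinh u₀ * sinh (y p) - 1)

lemma contDiff_planeGap {n : ℕ} (r u₀ v₀ : ℝ) (p q : Fin n) {k : WithTop ℕ∞} :
    ContDiff ℝ k (planeGap r u₀ v₀ p q) := by
  unfold planeGap
  fun_prop

lemma pd_planeGap {n : ℕ} (r u₀ v₀ : ℝ) (p q : Fin n) (y : EuclideanSpace ℝ (Fin n)) (i : Fin n) :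
    pd (planeGap r u₀ v₀ p q) y i =
      (if p = i then r * (cosh u₀ * (sinh (y p) * cosh (y q - v₀)) - sinh u₀ * cosh (y p)) else 0)
      + (if q = i then r * (cosh u₀ * (cosh (y p) * sinh (y q - v₀))) else 0) := by
  have hp := hasFDerivAt_coord p y
  have hq := (hasFDerivAt_coord q y).sub_const v₀
  have h := ((((hp.cosh.mul hq.cosh).const_mul (cosh u₀)).sub
    (hp.sinh.const_mul (sinh u₀))).sub_const 1).const_mul r
  refine (pd_eq_of_hasFDerivAt h i).trans ?_
  by_cases h1 : p = i <;> by_cases h2 : q = i <;> simp [h1, h2, mul_comm]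
  ring

lemma pd2_planeGap_self {n : ℕ} (r : ℝ) {p q : Fin n} (hpq : p ≠ q) (x : EuclideanSpace ℝ (Fin n))
    (i j : Fin n) :
    pd2 (planeGap r (x p) (x q) p q) x i j =
      if i = p ∧ j = p then r else if i = q ∧ j = q then r * cosh (x p) ^ 2 else 0 := by
  have hp := hasFDerivAt_coord p x
  have hq := (hasFDerivAt_coord q x).sub_const (x q)
  have hcs := cosh_sq_sub_sinh_sq (x p)
  rw [pd2]
  simp only [pd_planeGap]
  by_cases h1 : p = i
  · have hqi : q ≠ i := fun h => hpq (h1.trans h.symm)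
    simp only [h1, hqi, if_true, if_false, add_zero]
    subst h1
    have h := (((hp.sinh.mul hq.cosh).const_mul (cosh (x p))).sub
      (hp.cosh.const_mul (sinh (x p)))).const_mul r
    refine (pd_eq_of_hasFDerivAt h j).trans ?_
    by_cases h3 : p = j
    · subst h3
      simp
      linear_combination r * hcs
    · by_cases h4 : q = j
      · subst h4
        simp [hpq, hpq.symm]
      · simp [h3, Ne.symm h3, hpq]
  · by_cases h2 : q = i
    · simp only [h1, h2, if_true, if_false, zero_add]
      subst h2
      have h := ((hp.cosh.mul hq.sinh).const_mul (cosh (x p))).const_mul r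
      refine (pd_eq_of_hasFDerivAt h j).trans ?_
      by_cases h3 : p = j
      · subst h3
        simp [hpq, hpq.symm]
      · by_cases h4 : q = j
        · subst h4
          simp [hpq.symm]
          grind
        · simp [h4, Ne.symm h4, hpq.symm]
    · simp [h1, h2, Ne.symm h1, Ne.symm h2, pd]

lemma eta_eq_of_middle_zero {m : ℕ} (u v : EuclideanSpace ℝ (Fin (m + 3 + 2)))
    (h : ∀ k : Fin (m + 3 + 2), 3 ≤ (k : ℕ) → (k : ℕ) < m + 3 → u k = 0) :
    eta u v = -(u 0 * v 0) + u 1 * v 1 + u 2 * v 2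
      + u ⟨m + 3, by omega⟩ * v ⟨m + 3, by omega⟩ + u ⟨m + 4, by omega⟩ * v ⟨m + 4, by omega⟩ := by
  rw [eta, Fin.sum_univ_castSucc, Fin.sum_univ_castSucc, Fin.sum_univ_succ, Fin.sum_univ_succ,
    Finset.sum_eq_zero]
  · have e1 : (Fin.castSucc (Fin.castSucc (0 : Fin (m + 2)))).succ = (1 : Fin (m + 3 + 2)) := rfl
    have e2 : (Fin.castSucc (Fin.castSucc ((0 : Fin (m + 1)).succ))).succ
      = (2 : Fin (m + 3 + 2)) := rfl
    have e3 : (Fin.castSucc (Fin.last (m + 2))).succ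
      = (⟨m + 3, by omega⟩ : Fin (m + 3 + 2)) := rfl
    have e4 : (Fin.last (m + 3)).succ = (⟨m + 4, by omega⟩ : Fin (m + 3 + 2)) := rfl
    rw [e1, e2, e3, e4]
    ring
  · intro k _
    rw [h _ (by simp) (by simp), zero_mul]

/-- The unit normal field `(-r w, 0, …, 0, c, d)`, where `w` is the point of the hyperbolic plane
with coordinates `(x p, x q)`. -/
noncomputable def planeNormal {n N : ℕ} (r c d : ℝ) (p q : Fin n) (x : EuclideanSpace ℝ (Fin n)) :
    EuclideanSpace ℝ (Fin N) :=
  WithLp.toLp 2 fun k =>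
    if (k : ℕ) = 0 then -r * (cosh (x p) * cosh (x q))
    else if (k : ℕ) = 1 then -r * (cosh (x p) * sinh (x q))
    else if (k : ℕ) = 2 then -r * sinh (x p)
    else if (k : ℕ) + 2 = N then c
    else if (k : ℕ) + 1 = N then d
    else 0

lemma contDiff_planeNormal {n N : ℕ} (r c d : ℝ) (p q : Fin n) {k : WithTop ℕ∞} :
    ContDiff ℝ k (planeNormal (N := N) r c d p q) := by
  rw [contDiff_euclidean]
  intro l
  simp only [planeNormal]
  split_ifs <;> fun_prop

lemma planeNormal_apply {m n : ℕ} (r c d : ℝ) (p q : Fin n) (x : EuclideanSpace ℝ (Fin n)) :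
    (planeNormal r c d p q x : EuclideanSpace ℝ (Fin (m + 3 + 2))) 0
        = -r * (cosh (x p) * cosh (x q)) ∧
    (planeNormal r c d p q x : EuclideanSpace ℝ (Fin (m + 3 + 2))) 1
        = -r * (cosh (x p) * sinh (x q)) ∧
    (planeNormal r c d p q x : EuclideanSpace ℝ (Fin (m + 3 + 2))) 2 = -r * sinh (x p) ∧
    (planeNormal r c d p q x : EuclideanSpace ℝ (Fin (m + 3 + 2))) ⟨m + 3, by omega⟩ = c ∧
    (planeNormal r c d p q x : EuclideanSpace ℝ (Fin (m + 3 + 2))) ⟨m + 4, by omega⟩ = d := by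
  have h2 : ((2 : Fin (m + 3 + 2)) : ℕ) = 2 := rfl
  refine ⟨?_, ?_, ?_, ?_, ?_⟩ <;> simp only [planeNormal, h2] <;> simp

lemma eta_planeNormal {m n : ℕ} (r c d : ℝ) (p q : Fin n)
    (x : EuclideanSpace ℝ (Fin n)) (v : EuclideanSpace ℝ (Fin (m + 3 + 2))) :
    eta (planeNormal r c d p q x) v =
      r * (cosh (x p) * cosh (x q) * v 0 - cosh (x p) * sinh (x q) * v 1 - sinh (x p) * v 2)
      + c * v ⟨m + 3, by omega⟩ + d * v ⟨m + 4, by omega⟩ := by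
  obtain ⟨e0, e1, e2, e3, e4⟩ := planeNormal_apply (m := m) r c d p q x
  rw [eta_eq_of_middle_zero]
  · rw [e0, e1, e2, e3, e4]
    ring
  · intro k hk hk'
    simp only [planeNormal]
    rw [if_neg, if_neg, if_neg, if_neg, if_neg] <;> omega

theorem stmt16 (n : ℕ) (hn : 4 ≤ n) (a b : ℝ) (hab : 1 + a ^ 2 < b ^ 2)
    (U : Set (EuclideanSpace ℝ (Fin n)))
    (hU : U = {x | 0 < a * Real.sinh (x ⟨n - 3, by omega⟩) +
      b * Real.cosh (x ⟨n - 3, by omega⟩)})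
    (L : EuclideanSpace ℝ (Fin n) → EuclideanSpace ℝ (Fin (n + 2)))
    (hL : ∀ (x : EuclideanSpace ℝ (Fin n)) (k : Fin (n + 2)),
      L x k =
        (let S := Real.sinh (x ⟨n - 3, by omega⟩);
         let C := Real.cosh (x ⟨n - 3, by omega⟩);
         let P := ∏ j : Fin (n - 3), Real.cosh (x (Fin.castLE (by omega) j));
         if (k : ℕ) = 0 then
           (a * S + b * C) * Real.cosh (x ⟨n - 2, by omega⟩) *
             Real.cosh (x ⟨n - 1, by omega⟩) * P
         else if (k : ℕ) = 1 then
           (a * S + b * C) * Real.cosh (x ⟨n - 2, by omega⟩) *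
             Real.sinh (x ⟨n - 1, by omega⟩) * P
         else if (k : ℕ) = 2 then
           (a * S + b * C) * Real.sinh (x ⟨n - 2, by omega⟩) * P
         else if h : (k : ℕ) ≤ n - 1 then
           Real.sinh (x ⟨(k : ℕ) - 3, by omega⟩) *
             ∏ j : Fin ((k : ℕ) - 3), Real.cosh (x (Fin.castLE (by omega) j))
         else if (k : ℕ) = n then
           Real.sqrt (b ^ 2 - a ^ 2 - 1) / Real.sqrt (1 + a ^ 2) * C * P
         else
           (a * b * C + (1 + a ^ 2) * S) * P / Real.sqrt (1 + a ^ 2))) :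
    ∃ ξ : EuclideanSpace ℝ (Fin n) → EuclideanSpace ℝ (Fin (n + 2)),
      ContDiffOn ℝ (⊤ : ℕ∞) ξ U ∧
      ∀ x ∈ U,
        eta (ξ x) (ξ x) = 1 ∧
        eta (ξ x) (L x) = 0 ∧
        (∀ i : Fin n, eta (ξ x) (pd L x i) = 0) ∧
        (∀ i j : Fin n, ¬(i = j ∧ ((i : ℕ) = n - 2 ∨ (i : ℕ) = n - 1)) →
          eta (pd2 L x i j) (ξ x) = 0) ∧
        eta (pd2 L x ⟨n - 2, by omega⟩ ⟨n - 2, by omega⟩) (ξ x) =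
          Real.sqrt (b ^ 2 - a ^ 2 - 1) *
            (a * Real.sinh (x ⟨n - 3, by omega⟩) + b * Real.cosh (x ⟨n - 3, by omega⟩)) *
            (∏ j : Fin (n - 3), Real.cosh (x (Fin.castLE (by omega) j))) ∧
        eta (pd2 L x ⟨n - 1, by omega⟩ ⟨n - 1, by omega⟩) (ξ x) =
          Real.sqrt (b ^ 2 - a ^ 2 - 1) *
            (a * Real.sinh (x ⟨n - 3, by omega⟩) + b * Real.cosh (x ⟨n - 3, by omega⟩)) *
            (∏ j : Fin (n - 3), Real.cosh (x (Fin.castLE (by omega) j))) *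
            Real.cosh (x ⟨n - 2, by omega⟩) ^ 2 ∧
        Real.sqrt (b ^ 2 - a ^ 2 - 1) /
            ((a * Real.sinh (x ⟨n - 3, by omega⟩) + b * Real.cosh (x ⟨n - 3, by omega⟩)) *
              ∏ j : Fin (n - 3), Real.cosh (x (Fin.castLE (by omega) j))) ≠ 0 := by
  obtain ⟨m, rfl⟩ : ∃ m, n = m + 3 := ⟨n - 3, by omega⟩
  set t : Fin (m + 3) := ⟨m + 3 - 3, by omega⟩ with ht
  set p : Fin (m + 3) := ⟨m + 3 - 2, by omega⟩ with hp
  set q : Fin (m + 3) := ⟨m + 3 - 1, by omega⟩ with hq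
  have hpq : p ≠ q := by simp [hp, hq, Fin.ext_iff]
  set r := √(b ^ 2 - a ^ 2 - 1) with hr
  set s := √(1 + a ^ 2) with hs
  have hr0 : 0 < r := Real.sqrt_pos.2 (by linarith)
  have hs0 : 0 < s := Real.sqrt_pos.2 (by positivity)
  have hr2 : r ^ 2 = b ^ 2 - a ^ 2 - 1 := Real.sq_sqrt (by linarith)
  have hs2 : s ^ 2 = 1 + a ^ 2 := Real.sq_sqrt (by positivity)
  set F : EuclideanSpace ℝ (Fin (m + 3)) → ℝ := fun y =>
    (a * sinh (y t) + b * cosh (y t)) *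
      ∏ j : Fin (m + 3 - 3), cosh (y (Fin.castLE (by omega) j)) with hF
  have hFs : ContDiff ℝ 2 F := by
    refine ContDiff.mul (by fun_prop) (contDiff_prod fun j _ => by fun_prop)
  have hLs : ContDiff ℝ 2 L := by
    rw [contDiff_euclidean]
    intro k
    simp only [hL]
    have hprod : ∀ (l : ℕ) (hl : l ≤ m + 3), ContDiff ℝ 2
        fun y : EuclideanSpace ℝ (Fin (m + 3)) => ∏ j : Fin l, cosh (y (Fin.castLE hl j)) :=
      fun l hl => contDiff_prod fun j _ => by fun_prop
    have hP := hprod (m + 3 - 3) (by omega)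
    split_ifs with h0 h1 h2 h3 h4
    · exact ContDiff.mul (by fun_prop) hP
    · exact ContDiff.mul (by fun_prop) hP
    · exact ContDiff.mul (by fun_prop) hP
    · exact ContDiff.mul (by fun_prop) (hprod _ (by omega))
    · exact ContDiff.mul (by fun_prop) hP
    · exact (ContDiff.mul (by fun_prop) hP).div_const _
  have key : ∀ x y, eta (planeNormal r (-b / s) (-(r * a) / s) p q x) (L y) =
      F y * planeGap r (x p) (x q) p q y := by
    intro x y
    rw [eta_planeNormal, hL, hL, hL, hL, hL]
    have h1 : ((1 : Fin (m + 3 + 2)) : ℕ) = 1 := rfl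
    have h2 : ((2 : Fin (m + 3 + 2)) : ℕ) = 2 := rfl
    have h3 : ¬ (m + 3 ≤ m + 3 - 1) := by omega
    have h4 : ¬ (m + 4 ≤ m + 3 - 1) := by omega
    have h5 : ¬ (m + 3 = 1) := by omega
    have h6 : ¬ (m + 3 = 2) := by omega
    have h7 : ¬ (m + 4 = 1) := by omega
    have h8 : ¬ (m + 4 = 2) := by omega
    have h9 : ¬ (m + 4 = m + 3) := by omega
    simp only [h1, h2, h3, h4, h5, h6, h7, h8, h9, Fin.val_zero, hF, planeGap, cosh_sub,
      Nat.add_eq_zero_iff, OfNat.ofNat_ne_zero, one_ne_zero, and_false, if_true, if_false,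
      dite_false, OfNat.ofNat_ne_one]
    rw [← hs2]
    field_simp
    rw [hs2]
    ring
  have hdiff := hLs.differentiable (by norm_num)
  have hg0 : ∀ x, planeGap r (x p) (x q) p q x = 0 := by
    intro x
    have := cosh_sq_sub_sinh_sq (x p)
    simp only [planeGap, sub_self, cosh_zero]
    linear_combination r * this
  have hg1 : ∀ x i, pd (planeGap r (x p) (x q) p q) x i = 0 := by
    intro x i
    rw [pd_planeGap]
    simp [mul_comm]
  have hpd2 : ∀ x i j, eta (pd2 L x i j) (planeNormal r (-b / s) (-(r * a) / s) p q x) =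
      F x * if i = p ∧ j = p then r else if i = q ∧ j = q then r * cosh (x p) ^ 2 else 0 := by
    intro x i j
    rw [eta_comm, ← pd2_eta _ _ hLs, funext (key x),
      pd2_mul_of_critical_zero hFs (contDiff_planeGap ..) (hg0 x) (hg1 x),
      pd2_planeGap_self r hpq]
  refine ⟨planeNormal r (-b / s) (-(r * a) / s) p q, (contDiff_planeNormal ..).contDiffOn,
    fun x hx => ⟨?_, ?_, fun i => ?_, fun i j hij => ?_, ?_, ?_, ?_⟩⟩
  · obtain ⟨e0, e1, e2, e3, e4⟩ := planeNormal_apply (m := m) r (-b / s) (-(r * a) / s) p q x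
    rw [eta_planeNormal, e0, e1, e2, e3, e4]
    field_simp
    have hp1 := cosh_sq_sub_sinh_sq (x p)
    have hq1 := cosh_sq_sub_sinh_sq (x q)
    linear_combination (-r ^ 2 * s ^ 2 * cosh (x p) ^ 2) * hq1 - r ^ 2 * s ^ 2 * hp1
      + (a ^ 2 - s ^ 2) * hr2 + (a ^ 2 - b ^ 2) * hs2
  · rw [key, hg0, mul_zero]
  · rw [← pd_eta _ (hdiff x), funext (key x), pd_mul (hFs.differentiable (by norm_num) x)
      ((contDiff_planeGap (k := 2) ..).differentiable (by norm_num) x), hg0, hg1]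
    ring
  · rw [hpd2, if_neg, if_neg, mul_zero]
    · rintro ⟨rfl, rfl⟩
      exact hij ⟨rfl, Or.inr rfl⟩
    · rintro ⟨rfl, rfl⟩
      exact hij ⟨rfl, Or.inl rfl⟩
  · rw [hpd2, if_pos ⟨rfl, rfl⟩]
    ring
  · rw [hpd2, if_neg (fun h => hpq h.1.symm), if_pos ⟨rfl, rfl⟩]
    ring
  · rw [hU] at hx
    exact div_ne_zero hr0.ne' (mul_ne_zero (ne_of_gt hx)
      (Finset.prod_ne_zero_iff.2 fun j _ => (cosh_pos _).ne'))
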